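/- Let M be multiplication by β_1x_1 + ... + β_{n-1}x_{n-1} on the coinvariant algebra ℂ[β][x]/I (β_i = α_i + ... + α_{n-1}), and let R be the operator R𝔖_w = Σ_{w⋖u} (b_{w⋖u} − d_{w⋖u})𝔖_u in the Schubert basis. Then R·1 = 0 and (M + zR)^{C(n,2)}·1 = M^{C(n,2)}·1 for any scalar z. -/

import Mathlib

open Equiv Finset
open scoped Classical

/-- Number of inversions (Coxeter length) of a permutation of `Fin n`. -/
def invCount {n : ℕ} (v : Equiv.Perm (Fin n)) : ℕ :=
  (Finset.univ.filter (fun p : Fin n × Fin n => p.1 < p.2 ∧ v p.2 < v p.1)).card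

/-- `a` statistic of a (candidate) cover `v ⋖ v·t_{ij}`. -/
def aQ {n : ℕ} (v : Equiv.Perm (Fin n)) (i j : Fin n) : ℕ :=
  (Finset.univ.filter (fun k : Fin n => k < i ∧ v i < v k ∧ v k < v j)).card

/-- `b` statistic. -/
def bQ {n : ℕ} (v : Equiv.Perm (Fin n)) (i j : Fin n) : ℕ :=
  (Finset.univ.filter (fun k : Fin n => i < k ∧ k < j ∧ v j < v k)).card

/-- `c` statistic. -/
def cQ {n : ℕ} (v : Equiv.Perm (Fin n)) (i j : Fin n) : ℕ :=
  (Finset.univ.filter (fun k : Fin n => j < k ∧ v i < v k ∧ v k < v j)).card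

/-- `d` statistic. -/
def dQ {n : ℕ} (v : Equiv.Perm (Fin n)) (i j : Fin n) : ℕ :=
  (Finset.univ.filter (fun k : Fin n => i < k ∧ k < j ∧ v k < v i)).card

/-- Covering relation in strong Bruhat order. -/
def BruhatCov {n : ℕ} (v w : Equiv.Perm (Fin n)) : Prop :=
  ∃ i j : Fin n, i < j ∧ w = v * Equiv.swap i j ∧ invCount w = invCount v + 1

open MvPolynomial

/-- The ideal of `ℂ[x₁,…,xₙ]` generated by the symmetric polynomials with zero
constant term (so that the quotient is the coinvariant algebra). -/
noncomputable def coinvIdeal (n : ℕ) : Ideal (MvPolynomial (Fin n) ℂ) :=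
  Ideal.span {q : MvPolynomial (Fin n) ℂ | q.IsSymmetric ∧ constantCoeff q = 0}

section Permutations

variable {n : ℕ}

lemma swap_lt_swap_of_adjacent {r r' i j : Fin n} (hr : (r' : ℕ) = r + 1) (hij : i < j)
    (h : ¬(i = r ∧ j = r')) : swap r r' i < swap r r' j := by
  simp only [swap_apply_def]
  simp only [Fin.lt_def, Fin.ext_iff] at *
  split_ifs <;> omega

lemma mul_swap_apply_left (v : Perm (Fin n)) (r r' : Fin n) : (v * swap r r') r = v r' := by
  simp

lemma mul_swap_apply_right (v : Perm (Fin n)) (r r' : Fin n) : (v * swap r r') r' = v r := by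
  simp

lemma mul_swap_apply_of_ne (v : Perm (Fin n)) {r r' k : Fin n} (h : k ≠ r) (h' : k ≠ r') :
    (v * swap r r') k = v k := by
  simp [swap_apply_of_ne_of_ne h h']

lemma invCount_mul_swap_of_lt {v : Perm (Fin n)} {r r' : Fin n} (hr : (r' : ℕ) = r + 1)
    (hv : v r < v r') : invCount (v * swap r r') = invCount v + 1 := by
  have hrr : r < r' := by simp [Fin.lt_def, hr]
  have hmem : (r, r') ∈ univ.filter (fun p : Fin n × Fin n =>
      p.1 < p.2 ∧ (v * swap r r') p.2 < (v * swap r r') p.1) :=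
    mem_filter.2 ⟨mem_univ _, hrr, by simpa using hv⟩
  unfold invCount
  rw [← Finset.card_erase_add_one hmem]
  congr 1
  refine Finset.card_nbij' (fun p => (swap r r' p.1, swap r r' p.2))
    (fun p => (swap r r' p.1, swap r r' p.2)) ?_ ?_ ?_ ?_
  · rintro ⟨i, j⟩ hp
    rw [mem_coe, mem_erase, mem_filter] at hp
    rw [mem_coe, mem_filter]
    exact ⟨mem_univ _, swap_lt_swap_of_adjacent hr hp.2.2.1 (by simpa using hp.1), hp.2.2.2⟩
  · rintro ⟨i, j⟩ hp
    rw [mem_coe, mem_filter] at hp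
    rw [mem_coe, mem_erase, mem_filter]
    have hne : ¬(i = r ∧ j = r') := by
      rintro ⟨rfl, rfl⟩
      exact absurd hp.2.2 hv.not_gt
    refine ⟨fun h => ?_, mem_univ _, swap_lt_swap_of_adjacent hr hp.2.1 hne,
      by simpa using hp.2.2⟩
    simp only [Prod.mk.injEq, swap_apply_eq_iff, swap_apply_left, swap_apply_right] at h
    obtain ⟨rfl, rfl⟩ := h
    exact absurd hp.2.1 hrr.not_gt
  · rintro ⟨i, j⟩ -
    simp
  · rintro ⟨i, j⟩ -
    simp

lemma invCount_mul_swap_of_gt {v : Perm (Fin n)} {r r' : Fin n} (hr : (r' : ℕ) = r + 1)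
    (hv : v r' < v r) : invCount v = invCount (v * swap r r') + 1 := by
  have := invCount_mul_swap_of_lt (v := v * swap r r') hr (by simpa using hv)
  rwa [mul_assoc, swap_mul_self, mul_one] at this

lemma invCount_lt_mul_swap {v : Perm (Fin n)} {i j : Fin n} (hij : i < j) (hv : v i < v j) :
    invCount v < invCount (v * swap i j) := by
  obtain ⟨d, hd⟩ : ∃ d : ℕ, (j : ℕ) = i + 1 + d := ⟨j - (i + 1), by
    have := Fin.lt_def.1 hij; omega⟩
  induction d generalizing v i with
  | zero => rw [invCount_mul_swap_of_lt hd hv]; exact Nat.lt_succ_self _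
  | succ d ih =>
    obtain ⟨k, hk⟩ : ∃ k : Fin n, (k : ℕ) = i + 1 := ⟨⟨i + 1, by omega⟩, rfl⟩
    have hik : i ≠ k := by simp [Fin.ext_iff, hk]
    have hjk : j ≠ k := by simp only [ne_eq, Fin.ext_iff]; omega
    have hkj : k < j := by rw [Fin.lt_def]; omega
    have hsw : v * swap i j = v * swap i k * swap k j * swap i k := by
      rw [← swap_mul_swap_mul_swap hjk hij.ne', swap_comm k i, swap_comm k j]
      simp only [mul_assoc]
    have e1 : (v * swap i k * swap k j) i = v k := by
      rw [mul_swap_apply_of_ne _ hik hij.ne, mul_swap_apply_left]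
    have e2 : (v * swap i k * swap k j) k = v j := by
      rw [mul_swap_apply_left, mul_swap_apply_of_ne _ hij.ne' hjk]
    have h1 := ih (v := v * swap i k) (i := k) hkj
      (by rwa [mul_swap_apply_right, mul_swap_apply_of_ne _ hij.ne' hjk]) (by omega)
    rw [hsw]
    rcases lt_or_gt_of_ne (v.injective.ne hik) with h | h
    · have h2 := invCount_mul_swap_of_lt hk h
      rcases lt_or_gt_of_ne (v.injective.ne hjk) with h' | h'
      · have h3 := invCount_mul_swap_of_gt (v := v * swap i k * swap k j) hk (by rwa [e1, e2])
        omega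
      · have h3 := invCount_mul_swap_of_lt (v := v * swap i k * swap k j) hk (by rwa [e1, e2])
        omega
    · have h2 := invCount_mul_swap_of_gt hk h
      have h3 := invCount_mul_swap_of_lt (v := v * swap i k * swap k j) hk
        (by rw [e1, e2]; exact h.trans hv)
      omega

lemma lt_of_cover {v : Perm (Fin n)} {i j : Fin n} (hij : i < j)
    (hc : invCount (v * swap i j) = invCount v + 1) : v i < v j := by
  by_contra h
  have hlt : v j < v i := lt_of_le_of_ne (not_lt.1 h) (v.injective.ne hij.ne')
  have := invCount_lt_mul_swap (v := v * swap i j) hij (by simpa using hlt)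
  rw [mul_assoc, swap_mul_self, mul_one] at this
  omega

lemma not_between_of_cover {v : Perm (Fin n)} {i j k : Fin n} (hik : i < k) (hkj : k < j)
    (hc : invCount (v * swap i j) = invCount v + 1) : ¬(v i < v k ∧ v k < v j) := by
  rintro ⟨h1, h2⟩
  have hij := hik.trans hkj
  have a1 := invCount_lt_mul_swap hik h1
  have a2 := invCount_lt_mul_swap (v := v * swap i k) hij
    (by rwa [mul_swap_apply_left, mul_swap_apply_of_ne _ hij.ne' hkj.ne'])
  have a3 := invCount_lt_mul_swap (v := v * swap i k * swap i j) hkj (by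
    rw [mul_swap_apply_of_ne _ hik.ne' hkj.ne, mul_swap_apply_right, mul_swap_apply_right,
      mul_swap_apply_left]
    exact h1)
  have hsw : v * swap i j = v * swap i k * swap i j * swap k j := by
    have e1 := swap_mul_swap_mul_swap (x := j) (y := i) (z := k) hij.ne' hkj.ne'
    have e2 := swap_mul_swap_mul_swap (x := i) (y := k) (z := j) hik.ne hij.ne
    rw [← e1, swap_comm j i] at e2 ⊢
    simp only [mul_assoc, swap_mul_self, mul_one] at e2 ⊢
    rw [e2]
  rw [hsw] at hc
  omega

/-- The lifting property of the Bruhat order for covers. -/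
lemma mul_swap_ascent_of_cover {v : Perm (Fin n)} {r r' i j : Fin n} (hr : (r' : ℕ) = r + 1)
    (hv : v r < v r') (hij : i < j) (hne : ¬(i = r ∧ j = r'))
    (hc : invCount (v * swap i j) = invCount v + 1) :
    (v * swap i j) r < (v * swap i j) r' := by
  have hlt := lt_of_cover hij hc
  have hrr : r < r' := by simp [Fin.lt_def, hr]
  have hb := fun k h1 h2 => not_between_of_cover (k := k) h1 h2 hc
  by_cases h1 : r = i
  · subst h1
    have h2 : r' ≠ j := fun h => hne ⟨rfl, h.symm⟩
    have h3 : r' < j := by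
      simp only [Fin.lt_def, ne_eq, Fin.ext_iff] at *; omega
    rw [mul_swap_apply_left, mul_swap_apply_of_ne _ hrr.ne' h2]
    have := hb r' hrr h3
    exact lt_of_le_of_ne (not_lt.1 fun h => this ⟨hv, h⟩) (v.injective.ne h2.symm)
  by_cases h2 : r = j
  · subst h2
    rw [mul_swap_apply_right, mul_swap_apply_of_ne _ (hij.trans hrr).ne' hrr.ne']
    exact hlt.trans hv
  rw [mul_swap_apply_of_ne _ h1 h2]
  by_cases h3 : r' = i
  · subst h3
    rw [mul_swap_apply_left]
    exact hv.trans hlt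
  by_cases h4 : r' = j
  · subst h4
    have h5 : i < r := by
      simp only [Fin.lt_def, Fin.ext_iff] at *; omega
    rw [mul_swap_apply_right]
    have := hb r h5 hrr
    exact lt_of_le_of_ne (not_lt.1 fun h => this ⟨h, hv⟩) (v.injective.ne h1)
  rwa [mul_swap_apply_of_ne _ h3 h4]

lemma card_filter_fst_lt_snd (n : ℕ) :
    (univ.filter (fun p : Fin n × Fin n => p.1 < p.2)).card = n.choose 2 := by
  rw [Finset.card_filter, Fintype.sum_prod_type]
  simp_rw [← Finset.card_filter]
  have : ∀ i : Fin n, (univ.filter (fun j => i < j)).card = n - 1 - i := fun i => by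
    rw [← Fin.card_Ioi i]
    congr 1
    ext; simp
  simp_rw [this]
  rw [Fin.sum_univ_eq_sum_range (fun i => n - 1 - i) n, Finset.sum_range_reflect (fun i => i) n,
    Finset.sum_range_id, Nat.choose_two_right]

lemma invCount_le (v : Perm (Fin n)) : invCount v ≤ n.choose 2 := by
  rw [← card_filter_fst_lt_snd]
  refine Finset.card_le_card fun p => ?_
  simp only [mem_filter, mem_univ, true_and]
  exact fun h => h.1

lemma exists_ascent {w : Perm (Fin n)} (hw : w ≠ Fin.revPerm) :
    ∃ r r' : Fin n, (r' : ℕ) = r + 1 ∧ w r < w r' := by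
  by_contra! h
  apply hw
  have hanti : StrictAnti w := by
    cases n with
    | zero => exact fun i => i.elim0
    | succ m =>
      rw [Fin.strictAnti_iff_succ_lt]
      exact fun i => lt_of_le_of_ne (h i.castSucc i.succ (by simp))
        (w.injective.ne (Fin.castSucc_lt_succ (i := i)).ne')
  have hmono : StrictMono (fun i => w (Fin.rev i)) := fun i j hij => hanti (Fin.rev_lt_rev.2 hij)
  have h1 := Subsingleton.elim
    (hmono.orderIsoOfSurjective _ (w.surjective.comp Fin.rev_surjective)) (OrderIso.refl (Fin n))
  ext1 i
  have h2 := DFunLike.congr_fun h1 (Fin.rev i)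
  simpa using h2

/-- Induction on permutations downwards along the weak order, starting at the longest element. -/
lemma weakOrder_induction {P : Perm (Fin n) → Prop} (h0 : P Fin.revPerm)
    (hstep : ∀ (v : Perm (Fin n)) (r r' : Fin n), (r' : ℕ) = r + 1 → v r < v r' →
      P (v * swap r r') → P v) (v : Perm (Fin n)) : P v := by
  obtain ⟨d, hd⟩ : ∃ d, d = n.choose 2 - invCount v := ⟨_, rfl⟩
  induction d using Nat.strong_induction_on generalizing v with
  | _ d ih =>
    by_cases hv : v = Fin.revPerm
    · rwa [hv]
    · obtain ⟨r, r', hr, hlt⟩ := exists_ascent hv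
      have h1 := invCount_mul_swap_of_lt hr hlt
      have h2 := invCount_le (v * swap r r')
      exact hstep v r r' hr hlt (ih _ (by omega) _ rfl)

end Permutations

section Coinvariants

variable {n : ℕ}

lemma X_sub_X_dvd_sub_rename_swap (i j : Fin n) (f : MvPolynomial (Fin n) ℂ) :
    X i - X j ∣ f - rename (swap i j) f := by
  induction f using MvPolynomial.induction_on with
  | C a => simp
  | add p q hp hq =>
    rw [map_add, add_sub_add_comm]
    exact dvd_add hp hq
  | mul_X p k hp =>
    have hk : (X i - X j : MvPolynomial (Fin n) ℂ) ∣ X k - X (swap i j k) := by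
      rw [swap_apply_def]
      split_ifs with h1 h2
      · rw [h1]
      · rw [h2]; exact ⟨-1, by ring⟩
      · simp
    have : p * X k - rename (swap i j) (p * X k) =
        (p - rename (swap i j) p) * X k + rename (swap i j) p * (X k - X (swap i j k)) := by
      simp only [map_mul, rename_X]; ring
    rw [this]
    exact dvd_add (hp.mul_right _) (hk.mul_left _)

lemma X_sub_X_ne_zero {i j : Fin n} (hij : i ≠ j) : (X i - X j : MvPolynomial (Fin n) ℂ) ≠ 0 :=
  sub_ne_zero.2 fun h => hij (X_injective h)

lemma exists_divDiff_mem_coinvIdeal (i j : Fin n) {f : MvPolynomial (Fin n) ℂ}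
    (hf : f ∈ coinvIdeal n) :
    ∃ g ∈ coinvIdeal n, (X i - X j) * g = f - rename (swap i j) f := by
  induction hf using Submodule.span_induction with
  | mem p hp => exact ⟨0, zero_mem _, by rw [hp.1 (swap i j)]; simp⟩
  | zero => exact ⟨0, zero_mem _, by simp⟩
  | add p q _ _ hp hq =>
    obtain ⟨g, hg, eg⟩ := hp
    obtain ⟨g', hg', eg'⟩ := hq
    exact ⟨g + g', add_mem hg hg', by rw [mul_add, eg, eg', map_add]; ring⟩
  | smul a p hp ih =>
    obtain ⟨g, hg, eg⟩ := ih
    obtain ⟨b, hb⟩ := X_sub_X_dvd_sub_rename_swap i j a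
    refine ⟨rename (swap i j) a * g + b * p,
      add_mem (Ideal.mul_mem_left _ _ hg) (Ideal.mul_mem_left _ _ hp), ?_⟩
    rw [smul_eq_mul, map_mul]
    linear_combination rename (swap i j) a * eg - p * hb

/-- Divided differences preserve the ideal of the coinvariant algebra. -/
lemma divDiff_mem_coinvIdeal {i j : Fin n} (hij : i ≠ j) {f g : MvPolynomial (Fin n) ℂ}
    (hf : f ∈ coinvIdeal n) (hg : (X i - X j) * g = f - rename (swap i j) f) :
    g ∈ coinvIdeal n := by
  obtain ⟨g', hg', e⟩ := exists_divDiff_mem_coinvIdeal i j hf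
  rwa [mul_left_cancel₀ (X_sub_X_ne_zero hij) (hg.trans e.symm)]

lemma mem_coinvIdeal_of_swap_invariant {i j : Fin n} (hij : i ≠ j)
    {g : MvPolynomial (Fin n) ℂ} (hg : rename (swap i j) g = g)
    (h : X i * g ∈ coinvIdeal n) : g ∈ coinvIdeal n :=
  divDiff_mem_coinvIdeal hij h (by rw [map_mul, hg, rename_X, swap_apply_left]; ring)

/-- The derivation `∑ xᵢ² ∂/∂xᵢ`. -/
noncomputable def sqDeriv (n : ℕ) :
    Derivation ℂ (MvPolynomial (Fin n) ℂ) (MvPolynomial (Fin n) ℂ) :=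
  mkDerivation ℂ (fun i => X i ^ 2)

@[simp]
lemma sqDeriv_X (i : Fin n) : sqDeriv n (X i) = X i ^ 2 := mkDerivation_X _ _ _

lemma sqDeriv_rename (e : Perm (Fin n)) (f : MvPolynomial (Fin n) ℂ) :
    sqDeriv n (rename e f) = rename e (sqDeriv n f) := by
  induction f using MvPolynomial.induction_on with
  | C a => simp [sqDeriv]
  | add p q hp hq => simp [hp, hq]
  | mul_X p k hp => simp [hp]

lemma constantCoeff_sqDeriv (f : MvPolynomial (Fin n) ℂ) :
    constantCoeff (sqDeriv n f) = 0 := by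
  induction f using MvPolynomial.induction_on with
  | C a => simp [sqDeriv]
  | add p q hp hq => simp [hp, hq]
  | mul_X p k hp => simp [hp]

lemma sqDeriv_mem_coinvIdeal {f : MvPolynomial (Fin n) ℂ} (hf : f ∈ coinvIdeal n) :
    sqDeriv n f ∈ coinvIdeal n := by
  induction hf using Submodule.span_induction with
  | mem p hp =>
    refine Ideal.subset_span ⟨fun e => ?_, constantCoeff_sqDeriv p⟩
    rw [← sqDeriv_rename, hp.1 e]
  | zero => simp
  | add p q _ _ hp hq => rw [map_add]; exact add_mem hp hq
  | smul a p hp ih =>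
    rw [smul_eq_mul, Derivation.leibniz, smul_eq_mul, smul_eq_mul]
    exact add_mem (Ideal.mul_mem_left _ _ ih) (Ideal.mul_mem_right _ _ hp)

/-- In the coinvariant algebra, `∏ (T + xᵢ) = Tⁿ`. -/
lemma prod_X_add_C_mk_X (n : ℕ) :
    ∏ i : Fin n, (Polynomial.X + Polynomial.C (Ideal.Quotient.mk (coinvIdeal n) (X i))) =
      Polynomial.X ^ n := by
  have h := congrArg (Polynomial.map (Ideal.Quotient.mk (coinvIdeal n)))
    (MvPolynomial.prod_C_add_X_eq_sum_esymm ℂ (Fin n))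
  rw [Polynomial.map_prod, Polynomial.map_sum, Finset.sum_eq_single 0] at h
  · simpa using h
  · intro j _ hj
    have : Ideal.Quotient.mk (coinvIdeal n) (esymm (Fin n) ℂ j) = 0 := by
      refine Ideal.Quotient.eq_zero_iff_mem.2
        (Ideal.subset_span ⟨esymm_isSymmetric _ _ _, ?_⟩)
      rw [esymm, map_sum]
      refine Finset.sum_eq_zero fun t ht => ?_
      obtain ⟨i, hi⟩ : t.Nonempty := Finset.card_pos.1 (by
        rw [(mem_powersetCard.1 ht).2]; omega)
      rw [map_prod]
      exact Finset.prod_eq_zero hi (by simp)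
    simp [this]
  · simp

/-- If `∏ (T + xᵢ) = Tⁿ` and `xᵢ a = 0` for the first `m` of the `xᵢ`, then
`x_m ^ (n - m) a = 0`. -/
lemma pow_mul_eq_zero_of_prod_X_add_C {A : Type*} [CommRing A] {x : Fin n → A}
    (hx : ∏ i, (Polynomial.X + Polynomial.C (x i)) = Polynomial.X ^ n) {a : A} (m : Fin n)
    (ha : ∀ i < m, x i * a = 0) : x m ^ (n - (m : ℕ)) * a = 0 := by
  have h1 : ∀ s : Finset (Fin n), (∀ i ∈ s, i < m) →
      Polynomial.C a * ∏ i ∈ s, (Polynomial.X + Polynomial.C (x i)) =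
        Polynomial.C a * Polynomial.X ^ s.card := by
    intro s hs
    induction s using Finset.induction_on with
    | empty => simp
    | insert i s hi ih =>
      have h2 : Polynomial.C (x i) * Polynomial.C a = 0 := by
        rw [← Polynomial.C_mul, ha i (hs i (mem_insert_self _ _)), Polynomial.C_0]
      have h3 := ih fun j hj => hs j (mem_insert_of_mem hj)
      rw [prod_insert hi, card_insert_of_notMem hi, pow_succ]
      linear_combination (∏ j ∈ s, (Polynomial.X + Polynomial.C (x j))) * h2 + Polynomial.X * h3
  have h2 := h1 (univ.filter (· < m)) (by simp)
  have hcard : (univ.filter (· < m)).card = (m : ℕ) := by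
    rw [← Fin.card_Iio m]; congr 1; ext; simp
  rw [hcard] at h2
  have h3 := hx
  rw [← Finset.prod_filter_mul_prod_filter_not univ (· < m)] at h3
  have h4 : Polynomial.X ^ (m : ℕ) * (Polynomial.C a *
        ∏ i ∈ univ.filter (fun i => ¬ i < m), (Polynomial.X + Polynomial.C (x i))) =
      Polynomial.X ^ (m : ℕ) * (Polynomial.C a * Polynomial.X ^ (n - (m : ℕ))) := by
    have h5 : (Polynomial.X : Polynomial A) ^ n =
        Polynomial.X ^ (m : ℕ) * Polynomial.X ^ (n - (m : ℕ)) := by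
      rw [← pow_add]; congr 1; omega
    rw [h5] at h3
    linear_combination Polynomial.C a * h3 -
      (∏ i ∈ univ.filter (fun i => ¬ i < m), (Polynomial.X + Polynomial.C (x i))) * h2
  have h5 := congrArg (Polynomial.eval (-x m))
    ((Polynomial.monic_X_pow (m : ℕ)).isRegular.left h4)
  rw [Polynomial.eval_mul, Polynomial.eval_prod,
    Finset.prod_eq_zero (i := m) (by simp) (by simp)] at h5
  simp only [Polynomial.eval_mul, Polynomial.eval_C, Polynomial.eval_pow, Polynomial.eval_X,
    mul_zero, neg_pow (x m)] at h5
  have h6 := congrArg (fun t => (-1) ^ (n - (m : ℕ)) * t) h5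
  have h7 : ((-1 : A) ^ (n - (m : ℕ))) ^ 2 = 1 := by
    rw [← pow_mul]; exact Even.neg_one_pow (even_two.mul_left _)
  simp only [mul_zero] at h6
  linear_combination (-(x m ^ (n - (m : ℕ)) * a)) * h7 - h6

/-- The staircase monomial is annihilated by every variable in the coinvariant algebra. -/
lemma X_mul_staircase_mem (m : Fin n) :
    X m * ∏ i : Fin n, X i ^ (n - 1 - (i : ℕ)) ∈ coinvIdeal n := by
  have key : ∀ k : ℕ, ∀ i : Fin n, (i : ℕ) < k →
      Ideal.Quotient.mk (coinvIdeal n) (X i) * ∏ j ∈ univ.filter (fun j : Fin n => (j : ℕ) < k),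
        Ideal.Quotient.mk (coinvIdeal n) (X j) ^ (n - 1 - (j : ℕ)) = 0 := by
    intro k
    induction k with
    | zero => intro i hi; omega
    | succ k ih =>
      intro i hi
      by_cases hk : k < n
      · have hs : univ.filter (fun j : Fin n => (j : ℕ) < k + 1) =
            insert ⟨k, hk⟩ (univ.filter (fun j : Fin n => (j : ℕ) < k)) := by
          ext j; simp [Fin.ext_iff]; omega
        rw [hs, prod_insert (by simp)]
        by_cases hik : (i : ℕ) < k
        · rw [mul_left_comm, ih i hik, mul_zero]
        · obtain rfl : i = ⟨k, hk⟩ := Fin.ext (by simp; omega)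
          rw [← mul_assoc, ← pow_succ']
          have := pow_mul_eq_zero_of_prod_X_add_C (prod_X_add_C_mk_X n) ⟨k, hk⟩ (fun j hj => ih j hj)
          rw [← this]
          congr 2
          simp only
          omega
      · have hs : univ.filter (fun j : Fin n => (j : ℕ) < k + 1) =
            univ.filter (fun j : Fin n => (j : ℕ) < k) := by
          ext j; simp; omega
        rw [hs]
        exact ih i (by omega)
  have := key n m m.2
  rw [← Ideal.Quotient.eq_zero_iff_mem, map_mul, map_prod]
  simp_rw [map_pow]
  simpa using this

end Coinvariants

section Schubert

variable {n : ℕ}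

/-- The recursive characterization of Schubert polynomials by divided differences. -/
structure IsSchubertFamily (S : Perm (Fin n) → MvPolynomial (Fin n) ℂ) : Prop where
  longest : S Fin.revPerm = ∏ i : Fin n, X i ^ (n - 1 - (i : ℕ))
  divDiff : ∀ (v : Perm (Fin n)) (r r' : Fin n), (r' : ℕ) = r + 1 → v r < v r' →
    (X r - X r') * S v = S (v * swap r r') - rename (swap r r') (S (v * swap r r'))

/-- The transpositions leading to covers of `w` in the Bruhat order. -/
noncomputable def covers (w : Perm (Fin n)) : Finset (Fin n × Fin n) :=
  univ.filter (fun p => p.1 < p.2 ∧ invCount (w * swap p.1 p.2) = invCount w + 1)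

lemma mem_covers {w : Perm (Fin n)} {p : Fin n × Fin n} :
    p ∈ covers w ↔ p.1 < p.2 ∧ invCount (w * swap p.1 p.2) = invCount w + 1 := by
  rw [covers, mem_filter]
  simp

lemma covers_revPerm : covers (Fin.revPerm : Perm (Fin n)) = ∅ := by
  refine Finset.eq_empty_of_forall_notMem fun p hp => ?_
  rw [mem_covers] at hp
  have := lt_of_cover hp.1 hp.2
  simp only [Fin.revPerm_apply, Fin.rev_lt_rev] at this
  exact absurd hp.1 this.not_gt

variable {S : Perm (Fin n) → MvPolynomial (Fin n) ℂ}

local notation "mk" => Ideal.Quotient.mk (coinvIdeal n)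

lemma mk_smul (c : ℂ) (f : MvPolynomial (Fin n) ℂ) : mk (c • f) = c • mk f := rfl

lemma IsSchubertFamily.rename_of_ascent (hS : IsSchubertFamily S) {v : Perm (Fin n)}
    {r r' : Fin n} (hr : (r' : ℕ) = r + 1) (hv : v r < v r') :
    rename (swap r r') (S v) = S v := by
  have hne : r ≠ r' := fun h => hv.ne (by rw [h])
  have h := hS.divDiff v r r' hr hv
  have h' := congrArg (rename (swap r r')) h
  rw [map_mul, map_sub, map_sub, rename_X, rename_X, swap_apply_left, swap_apply_right,
    rename_rename] at h'
  have hid : (swap r r' : Fin n → Fin n) ∘ swap r r' = id := by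
    ext x; simp
  rw [hid, rename_id_apply] at h'
  refine mul_left_cancel₀ (X_sub_X_ne_zero hne) ?_
  linear_combination -h' - h

lemma IsSchubertFamily.divDiff_ite (hS : IsSchubertFamily S) {r r' : Fin n}
    (hr : (r' : ℕ) = r + 1) (u : Perm (Fin n)) :
    (X r - X r') * (if u r' < u r then S (u * swap r r') else 0) =
      S u - rename (swap r r') (S u) := by
  have hne : r ≠ r' := by simp [Fin.ext_iff, hr]
  split_ifs with h
  · have := hS.divDiff (u * swap r r') r r' hr (by simpa using h)
    rwa [mul_assoc u, swap_mul_self, mul_one] at this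
  · rw [hS.rename_of_ascent hr (lt_of_le_of_ne (not_lt.1 h) (u.injective.ne hne))]
    simp

/-- Divided differences applied to an expansion over the covers of `v * swap r r'`. -/
lemma IsSchubertFamily.mk_divDiff_eq_sum (hS : IsSchubertFamily S) {v : Perm (Fin n)}
    {r r' : Fin n} (hr : (r' : ℕ) = r + 1) (hv : v r < v r')
    {f g : MvPolynomial (Fin n) ℂ} {c : Fin n × Fin n → ℂ}
    (hf : mk f = ∑ p ∈ covers (v * swap r r'),
      c p • mk (S (v * swap r r' * swap p.1 p.2)))
    (hg : (X r - X r') * g = f - rename (swap r r') f) :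
    mk g = ∑ p ∈ (covers v).erase (r, r'),
      c (swap r r' p.1, swap r r' p.2) • mk (S (v * swap p.1 p.2)) := by
  have hne : r ≠ r' := by simp [Fin.ext_iff, hr]
  have hrr : r < r' := by simp [Fin.lt_def, hr]
  have hw := invCount_mul_swap_of_lt hr hv
  set w := v * swap r r' with hwdef
  let T : Perm (Fin n) → MvPolynomial (Fin n) ℂ :=
    fun u => if u r' < u r then S (u * swap r r') else 0
  have h1 : f - ∑ p ∈ covers w, c p • S (w * swap p.1 p.2) ∈ coinvIdeal n := by
    rw [← Ideal.Quotient.eq, hf, map_sum]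
    rfl
  have h2 : g - ∑ p ∈ covers w, c p • T (w * swap p.1 p.2) ∈ coinvIdeal n := by
    refine divDiff_mem_coinvIdeal hne h1 ?_
    rw [mul_sub, hg, mul_sum, map_sub, map_sum]
    have : ∀ p ∈ covers w, (X r - X r') * (c p • T (w * swap p.1 p.2)) =
        c p • S (w * swap p.1 p.2) - rename (swap r r') (c p • S (w * swap p.1 p.2)) := by
      intro p _
      rw [mul_smul_comm, hS.divDiff_ite hr, map_smul, smul_sub]
    rw [sum_congr rfl this, sum_sub_distrib]
    ring
  rw [Ideal.Quotient.eq.2 h2, map_sum]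
  have h3 : ∀ p ∈ covers w, mk (c p • T (w * swap p.1 p.2)) =
      if (w * swap p.1 p.2) r' < (w * swap p.1 p.2) r then
        c p • mk (S (w * swap p.1 p.2 * swap r r')) else 0 := by
    intro p _
    simp only [T]
    split_ifs
    · rfl
    · simp
  rw [sum_congr rfl h3, ← sum_filter]
  have hwv : w * swap r r' = v := by rw [hwdef, mul_assoc, swap_mul_self, mul_one]
  have hconj : ∀ a b, w * swap a b * swap r r' = v * swap (swap r r' a) (swap r r' b) := by
    intro a b
    rw [swap_apply_apply, hwdef, swap_inv]
    simp only [mul_assoc]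
  have hconj' : ∀ a b, w * swap (swap r r' a) (swap r r' b) = v * swap a b * swap r r' := by
    intro a b
    rw [swap_apply_apply, hwdef, swap_inv]
    simp only [mul_assoc, swap_mul_self_mul]
  refine Finset.sum_nbij' (fun p => (swap r r' p.1, swap r r' p.2))
    (fun p => (swap r r' p.1, swap r r' p.2)) ?_ ?_ ?_ ?_ ?_
  · rintro ⟨a, b⟩ hp
    rw [mem_filter, mem_covers] at hp
    obtain ⟨⟨hab, hc⟩, hd⟩ := hp
    dsimp only at hab hc hd
    have hd' := invCount_mul_swap_of_gt hr hd
    rw [hconj] at hd'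
    have hn : ¬(a = r ∧ b = r') := by
      rintro ⟨rfl, rfl⟩
      rw [hwv] at hc
      omega
    rw [mem_erase, mem_covers]
    refine ⟨fun h => ?_, swap_lt_swap_of_adjacent hr hab hn, by dsimp only; omega⟩
    simp only [Prod.mk.injEq, swap_apply_eq_iff, swap_apply_left, swap_apply_right] at h
    obtain ⟨rfl, rfl⟩ := h
    exact absurd hab hrr.not_gt
  · rintro ⟨a, b⟩ hp
    rw [mem_erase, mem_covers] at hp
    obtain ⟨hn, hab, hc⟩ := hp
    have hn : ¬(a = r ∧ b = r') := by simpa using hn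
    dsimp only at hab hc
    have ha := mul_swap_ascent_of_cover hr hv hab hn hc
    have hi := invCount_mul_swap_of_lt hr ha
    rw [mem_filter, mem_covers]
    dsimp only
    rw [hconj']
    refine ⟨⟨swap_lt_swap_of_adjacent hr hab hn, by omega⟩, ?_⟩
    rwa [mul_swap_apply_left, mul_swap_apply_right]
  · rintro ⟨a, b⟩ -
    simp
  · rintro ⟨a, b⟩ -
    simp
  · rintro ⟨a, b⟩ -
    simp only [swap_apply_self, hconj]

lemma mem_covers_of_ascent {v : Perm (Fin n)} {r r' : Fin n} (hr : (r' : ℕ) = r + 1)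
    (hv : v r < v r') : (r, r') ∈ covers v :=
  mem_covers.2 ⟨by simp [Fin.lt_def, hr], invCount_mul_swap_of_lt hr hv⟩

/-- Monk's rule in the coinvariant algebra. -/
lemma IsSchubertFamily.monk (hS : IsSchubertFamily S) (w : Perm (Fin n)) (m : Fin n) :
    mk (X m * S w) = ∑ p ∈ covers w,
      ((if p.1 = m then 1 else 0) - (if p.2 = m then 1 else 0) : ℂ) •
        mk (S (w * swap p.1 p.2)) := by
  induction w using weakOrder_induction generalizing m with
  | h0 =>
    rw [covers_revPerm, sum_empty, hS.longest]
    exact Ideal.Quotient.eq_zero_iff_mem.2 (X_mul_staircase_mem m)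
  | hstep v r r' hr hv ih =>
    have hne : r ≠ r' := by simp [Fin.ext_iff, hr]
    have hF := hS.divDiff v r r' hr hv
    have h := hS.mk_divDiff_eq_sum hr hv
      (g := X m * S v + ((if r' = m then 1 else 0) - (if r = m then 1 else 0) : ℂ) •
        S (v * swap r r')) (ih (swap r r' m)) (by
      rw [map_mul, rename_X, swap_apply_self, mul_add, mul_left_comm, hF]
      by_cases h1 : r = m
      · subst h1
        simp only [swap_apply_left, if_true, if_neg hne.symm]
        rw [zero_sub, neg_one_smul]
        ring
      · by_cases h2 : r' = m
        · subst h2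
          simp only [swap_apply_right, if_true, if_neg hne]
          rw [sub_zero, one_smul]
          ring
        · simp only [swap_apply_of_ne_of_ne (Ne.symm h1) (Ne.symm h2), if_neg h1, if_neg h2]
          simp
          ring)
    rw [map_add, mk_smul] at h
    simp only [(swap r r').injective.eq_iff] at h
    rw [← Finset.sum_erase_add _ _ (mem_covers_of_ascent hr hv), ← h, add_assoc, ← add_smul]
    simp

lemma sqDeriv_prod_X_pow (s : Finset (Fin n)) (e : Fin n → ℕ) :
    sqDeriv n (∏ i ∈ s, X i ^ e i) =
      (∑ i ∈ s, (e i : MvPolynomial (Fin n) ℂ) * X i) * ∏ i ∈ s, X i ^ e i := by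
  induction s using Finset.induction_on with
  | empty => simp
  | insert i s hi ih =>
    have h1 : sqDeriv n (X i ^ e i) = (e i : MvPolynomial (Fin n) ℂ) * X i * X i ^ e i := by
      rw [Derivation.leibniz_pow, sqDeriv_X]
      rcases Nat.eq_zero_or_pos (e i) with h | h
      · simp [h]
      · obtain ⟨k, hk⟩ : ∃ k, e i = k + 1 := ⟨e i - 1, by omega⟩
        rw [hk, Nat.add_sub_cancel, smul_eq_mul, nsmul_eq_mul]
        ring
    rw [prod_insert hi, sum_insert hi, Derivation.leibniz, ih, h1, smul_eq_mul, smul_eq_mul]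
    ring

lemma dQ_sub_bQ_eq_sum (v : Perm (Fin n)) (i j : Fin n) :
    ((dQ v i j : ℂ) - (bQ v i j : ℂ)) = ∑ k, if i < k ∧ k < j then
      ((if v k < v i then 1 else 0) - (if v j < v k then 1 else 0) : ℂ) else 0 := by
  rw [dQ, bQ, Finset.card_filter, Finset.card_filter, Nat.cast_sum, Nat.cast_sum,
    ← Finset.sum_sub_distrib]
  refine Finset.sum_congr rfl fun k _ => ?_
  by_cases h1 : i < k <;> by_cases h2 : k < j <;> simp [h1, h2]

/-- How the statistic `d - b` of a cover changes under an adjacent transposition. -/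
lemma dQ_sub_bQ_mul_swap {v : Perm (Fin n)} {r r' a b : Fin n} (hr : (r' : ℕ) = r + 1)
    (hv : v r < v r') (hab : a < b) (hne : ¬(a = r ∧ b = r'))
    (hc : invCount (v * swap a b) = invCount v + 1) :
    ((dQ v a b : ℂ) - (bQ v a b : ℂ)) +
        (((if a = r then 1 else 0) - (if b = r then 1 else 0)) +
          ((if a = r' then 1 else 0) - (if b = r' then 1 else 0))) =
      (dQ (v * swap r r') (swap r r' a) (swap r r' b) : ℂ) -
        (bQ (v * swap r r') (swap r r' a) (swap r r' b) : ℂ) := by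
  have hlt := lt_of_cover hab hc
  have hrr : r < r' := by simp [Fin.lt_def, hr]
  have hb := fun k h1 h2 => not_between_of_cover (k := k) h1 h2 hc
  rw [dQ_sub_bQ_eq_sum, dQ_sub_bQ_eq_sum, ← Equiv.sum_comp (swap r r') (fun k => if swap r r' a < k ∧ k < swap r r' b then _ else _)]
  simp only [Perm.mul_apply, swap_apply_self]
  suffices H : ∃ (k₀ : Fin n) (ε : ℂ), (∀ k,
      (if swap r r' a < swap r r' k ∧ swap r r' k < swap r r' b then
        ((if v k < v a then 1 else 0) - (if v b < v k then 1 else 0) : ℂ) else 0) =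
      (if a < k ∧ k < b then
        ((if v k < v a then 1 else 0) - (if v b < v k then 1 else 0) : ℂ) else 0) +
      (if k = k₀ then ε else 0)) ∧
      ε = ((if a = r then 1 else 0) - (if b = r then 1 else 0)) +
          ((if a = r' then 1 else 0) - (if b = r' then 1 else 0)) by
    obtain ⟨k₀, ε, h1, h2⟩ := H
    rw [← h2, Finset.sum_congr rfl fun k _ => h1 k, Finset.sum_add_distrib]
    simp
  have hs : ∀ k, k ≠ r → k ≠ r' → swap r r' k = k := fun k h h' =>
    swap_apply_of_ne_of_ne h h'
  by_cases h1 : a = r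
  · subst h1
    have h2 : b ≠ r' := fun h => hne ⟨rfl, h⟩
    have h3 : r' < b := by simp only [Fin.lt_def, ne_eq, Fin.ext_iff] at *; omega
    have h4 : v b < v r' := lt_of_le_of_ne
      (not_lt.1 fun h => hb r' hrr h3 ⟨hv, h⟩) (v.injective.ne h2)
    refine ⟨r', 1, fun k => ?_, by simp [hrr.ne, hab.ne', h2]⟩
    rw [hs b hab.ne' h2, swap_apply_left]
    by_cases hk : k = r'
    · subst hk
      simp [hrr, h3, h4, hv.not_gt, hrr.not_gt]
    · by_cases hk' : k = a
      · subst hk'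
        simp [hrr.ne]
      · have : r' < k ↔ a < k := by
          simp only [Fin.lt_def, Fin.ext_iff] at *; omega
        simp [hs k hk' hk, hk, this]
  by_cases h2 : a = r'
  · subst h2
    have h3 : r < b := hrr.trans hab
    refine ⟨r, 1, fun k => ?_, by simp [hrr.ne', hab.ne', h3.ne']⟩
    rw [hs b h3.ne' hab.ne', swap_apply_right]
    by_cases hk : k = r
    · subst hk
      simp [hrr, hab, hv, (hv.trans hlt).not_gt, hrr.not_gt]
    · by_cases hk' : k = a
      · subst hk'
        simp [hrr.ne']
      · have : r < k ↔ a < k := by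
          simp only [Fin.lt_def, Fin.ext_iff] at *; omega
        simp [hs k hk hk', hk, this]
  rw [hs a h1 h2]
  by_cases h3 : b = r
  · subst h3
    refine ⟨r', -1, fun k => ?_, by simp [h1, h2, hrr.ne]⟩
    rw [swap_apply_left]
    by_cases hk : k = r'
    · subst hk
      simp [hrr, hab, hv, (hlt.trans hv).not_gt, hrr.not_gt]
    · by_cases hk' : k = b
      · subst hk'
        simp [hrr.ne]
      · have : k < r' ↔ k < b := by
          simp only [Fin.lt_def, Fin.ext_iff] at *; omega
        simp [hs k hk' hk, hk, this]
  by_cases h4 : b = r'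
  · subst h4
    have h5 : a < r := by simp only [Fin.lt_def, Fin.ext_iff] at *; omega
    have h6 : v r < v a := lt_of_le_of_ne
      (not_lt.1 fun h => hb r h5 hrr ⟨h, hv⟩) (v.injective.ne h5.ne')
    refine ⟨r, -1, fun k => ?_, by simp [h1, h2, hrr.ne']⟩
    rw [swap_apply_right]
    by_cases hk : k = r
    · subst hk
      simp [hrr, h5, h6, hv.not_gt, hrr.not_gt]
    · by_cases hk' : k = b
      · subst hk'
        simp [hrr.ne']
      · have : k < r ↔ k < b := by
          simp only [Fin.lt_def, Fin.ext_iff] at *; omega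
        simp [hs k hk hk', hk, this]
  rw [hs b h3 h4]
  refine ⟨r, 0, fun k => ?_, by simp [h1, h2, h3, h4]⟩
  have : (a < swap r r' k ∧ swap r r' k < b) ↔ (a < k ∧ k < b) := by
    by_cases hk : k = r
    · subst hk
      rw [swap_apply_left]
      simp only [Fin.lt_def, Fin.ext_iff] at *; omega
    by_cases hk' : k = r'
    · subst hk'
      rw [swap_apply_right]
      simp only [Fin.lt_def, Fin.ext_iff] at *; omega
    rw [hs k hk hk']
  simp [this]

lemma IsSchubertFamily.mk_sqDeriv (hS : IsSchubertFamily S) (w : Perm (Fin n)) :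
    mk (sqDeriv n (S w)) = ∑ p ∈ covers w,
      ((dQ w p.1 p.2 : ℂ) - (bQ w p.1 p.2 : ℂ)) • mk (S (w * swap p.1 p.2)) := by
  induction w using weakOrder_induction with
  | h0 =>
    rw [covers_revPerm, sum_empty, hS.longest, sqDeriv_prod_X_pow, sum_mul]
    refine Ideal.Quotient.eq_zero_iff_mem.2 (sum_mem fun m _ => ?_)
    rw [mul_assoc]
    exact Ideal.mul_mem_left _ _ (X_mul_staircase_mem m)
  | hstep v r r' hr hv ih =>
    have hne : r ≠ r' := by simp [Fin.ext_iff, hr]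
    have hF := hS.divDiff v r r' hr hv
    have hDF := congrArg (sqDeriv n) hF
    rw [map_sub, sqDeriv_rename, Derivation.leibniz, map_sub, sqDeriv_X, sqDeriv_X,
      smul_eq_mul, smul_eq_mul] at hDF
    have h := hS.mk_divDiff_eq_sum hr hv
      (g := sqDeriv n (S v) + (X r * S v + X r' * S v)) ih (by linear_combination hDF)
    rw [map_add, map_add, hS.monk, hS.monk, ← sum_add_distrib, ← eq_sub_iff_add_eq] at h
    have hcov := mem_covers_of_ascent hr hv
    rw [h, ← Finset.sum_erase_add _ _ hcov, ← Finset.sum_erase_add _ _ hcov]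
    have h0 : (dQ v r r' : ℂ) - (bQ v r r' : ℂ) = 0 := by
      rw [dQ_sub_bQ_eq_sum]
      refine Finset.sum_eq_zero fun k _ => if_neg ?_
      simp only [Fin.lt_def]; omega
    simp only [h0, hne, hne.symm, if_true, if_false]
    simp only [sub_zero, zero_sub, one_smul, neg_smul, add_neg_cancel, add_zero, zero_smul]
    rw [← sum_sub_distrib]
    refine sum_congr rfl fun p hp => ?_
    obtain ⟨hn, hp⟩ := mem_erase.1 hp
    obtain ⟨hab, hc⟩ := mem_covers.1 hp
    rw [← dQ_sub_bQ_mul_swap hr hv hab (fun h => hn (Prod.ext h.1 h.2)) hc, ← add_smul,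
      ← sub_smul, add_sub_cancel_right]

end Schubert

section Dominant

variable {n : ℕ}

/-- The Lehmer code of a permutation. -/
noncomputable def lehmer (w : Perm (Fin n)) (i : Fin n) : ℕ :=
  (univ.filter (fun j => i < j ∧ w j < w i)).card

lemma lehmer_mul_swap_left {v : Perm (Fin n)} {r r' : Fin n} (hr : (r' : ℕ) = r + 1)
    (hv : v r < v r') : lehmer (v * swap r r') r = lehmer v r' + 1 := by
  have hrr : r < r' := by simp [Fin.lt_def, hr]
  have h : univ.filter (fun j => r < j ∧ (v * swap r r') j < (v * swap r r') r) =
      insert r' (univ.filter (fun j => r' < j ∧ v j < v r')) := by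
    ext j
    rw [mem_filter, mem_insert, mem_filter, mul_swap_apply_left]
    by_cases h1 : j = r'
    · subst h1; simp [hrr, hv]
    by_cases h2 : j = r
    · subst h2; simp [hrr.ne, hrr.not_gt]
    rw [mul_swap_apply_of_ne _ h2 h1]
    have : r < j ↔ r' < j := by simp only [Fin.lt_def, Fin.ext_iff] at *; omega
    simp [h1, this]
  rw [lehmer, h, card_insert_of_notMem (by simp), lehmer]

lemma lehmer_mul_swap_right {v : Perm (Fin n)} {r r' : Fin n} (hr : (r' : ℕ) = r + 1)
    (hv : v r < v r') : lehmer (v * swap r r') r' = lehmer v r := by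
  have hrr : r < r' := by simp [Fin.lt_def, hr]
  unfold lehmer
  congr 1
  ext j
  rw [mem_filter, mem_filter, mul_swap_apply_right]
  by_cases h1 : j = r'
  · subst h1; simp [hv.not_gt]
  by_cases h2 : j = r
  · subst h2; simp [hrr.not_gt]
  rw [mul_swap_apply_of_ne _ h2 h1]
  have : r < j ↔ r' < j := by simp only [Fin.lt_def, Fin.ext_iff] at *; omega
  simp [this]

lemma lehmer_mul_swap_of_ne (v : Perm (Fin n)) {r r' k : Fin n} (hr : (r' : ℕ) = r + 1)
    (h : k ≠ r) (h' : k ≠ r') : lehmer (v * swap r r') k = lehmer v k := by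
  unfold lehmer
  refine Finset.card_nbij' (swap r r') (swap r r') ?_ ?_ ?_ ?_
  · intro j hj
    rw [mem_coe, mem_filter, mul_swap_apply_of_ne v h h'] at hj
    rw [mem_coe, mem_filter]
    refine ⟨mem_univ _, ?_, hj.2.2⟩
    have := swap_lt_swap_of_adjacent hr hj.2.1 (fun hh => h hh.1)
    rwa [swap_apply_of_ne_of_ne h h'] at this
  · intro j hj
    rw [mem_coe, mem_filter] at hj
    rw [mem_coe, mem_filter, mul_swap_apply_of_ne v h h']
    refine ⟨mem_univ _, ?_, by simpa using hj.2.2⟩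
    have := swap_lt_swap_of_adjacent hr hj.2.1 (fun hh => h hh.1)
    rwa [swap_apply_of_ne_of_ne h h'] at this
  · intro j _; simp
  · intro j _; simp

lemma lehmer_le_of_ascent {v : Perm (Fin n)} {r r' : Fin n} (hr : (r' : ℕ) = r + 1)
    (hv : v r < v r') : lehmer v r ≤ lehmer v r' := by
  refine card_le_card fun j => ?_
  rw [mem_filter, mem_filter]
  rintro ⟨-, h1, h2⟩
  have h3 : j ≠ r' := by rintro rfl; exact hv.not_gt h2
  refine ⟨mem_univ _, ?_, h2.trans hv⟩
  simp only [Fin.lt_def, ne_eq, Fin.ext_iff] at *; omega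

lemma lehmer_lt_of_descent {v : Perm (Fin n)} {r r' : Fin n} (hr : (r' : ℕ) = r + 1)
    (hv : v r' < v r) : lehmer v r' < lehmer v r := by
  have hv' : (v * swap r r') r < (v * swap r r') r' := by simpa using hv
  have h1 := lehmer_mul_swap_left hr hv'
  have h2 := lehmer_mul_swap_right hr hv'
  have h3 := lehmer_le_of_ascent hr hv'
  rw [mul_assoc, swap_mul_self, mul_one] at h1 h2
  omega

/-- The Schubert polynomial of a dominant permutation is a monomial. -/
lemma IsSchubertFamily.eq_prod_of_dominant {S : Perm (Fin n) → MvPolynomial (Fin n) ℂ}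
    (hS : IsSchubertFamily S) (w : Perm (Fin n))
    (hw : ∀ q q' : Fin n, (q' : ℕ) = q + 1 → lehmer w q' ≤ lehmer w q) :
    S w = ∏ i, X i ^ lehmer w i := by
  obtain ⟨d, hd⟩ : ∃ d, d = n.choose 2 - invCount w := ⟨_, rfl⟩
  induction d using Nat.strong_induction_on generalizing w with
  | _ d ih =>
    by_cases hrev : w = Fin.revPerm
    · subst hrev
      rw [hS.longest]
      refine prod_congr rfl fun i _ => ?_
      congr 1
      rw [← Fin.card_Ioi i, lehmer]
      congr 1
      ext j
      simp
    obtain ⟨r, ⟨r', hr, hlt⟩, hmin⟩ := wellFounded_lt.has_min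
      {r : Fin n | ∃ r' : Fin n, (r' : ℕ) = r + 1 ∧ w r < w r'}
      (by obtain ⟨r, r', h⟩ := exists_ascent hrev; exact ⟨r, r', h⟩)
    have hne : r ≠ r' := by simp [Fin.ext_iff, hr]
    have heq : lehmer w r' = lehmer w r :=
      le_antisymm (hw r r' hr) (lehmer_le_of_ascent hr hlt)
    have hl := lehmer_mul_swap_left hr hlt
    have hl' := lehmer_mul_swap_right hr hlt
    have h1 := invCount_mul_swap_of_lt hr hlt
    have h2 := invCount_le (w * swap r r')
    have key := ih _ (by omega) (w * swap r r') (fun q q' hq => by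
      by_cases hq1 : q' = r
      · subst hq1
        have hqq : q < q' := by simp [Fin.lt_def, hq]
        have hqr : q ≠ r' := by simp only [ne_eq, Fin.ext_iff]; omega
        have hdesc : w q' < w q := by
          refine lt_of_le_of_ne (not_lt.1 fun h => hmin q ⟨q', hq, h⟩ hqq)
            (w.injective.ne hqq.ne')
        have := lehmer_lt_of_descent hq hdesc
        rw [lehmer_mul_swap_of_ne w hr hqq.ne hqr]
        omega
      by_cases hq2 : q = r
      · subst hq2
        obtain rfl : q' = r' := Fin.ext (by omega)
        omega
      have hq3 : q' ≠ r' := by simp only [ne_eq, Fin.ext_iff] at *; omega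
      rw [lehmer_mul_swap_of_ne w hr hq1 hq3]
      by_cases hq4 : q = r'
      · subst hq4
        have := hw q q' hq
        omega
      rw [lehmer_mul_swap_of_ne w hr hq2 hq4]
      exact hw q q' hq) rfl
    have hsplit : ∀ e : Fin n → ℕ, ∏ i, (X i : MvPolynomial (Fin n) ℂ) ^ e i =
        X r ^ e r * (X r' ^ e r' * ∏ i ∈ (univ.erase r).erase r', X i ^ e i) := fun e => by
      rw [mul_prod_erase _ (fun i => X i ^ e i) (by simp [hne.symm]),
        mul_prod_erase _ (fun i => X i ^ e i) (mem_univ r)]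
    have hP : ∏ i ∈ (univ.erase r).erase r', (X i : MvPolynomial (Fin n) ℂ) ^
        lehmer (w * swap r r') i = ∏ i ∈ (univ.erase r).erase r', X i ^ lehmer w i := by
      refine prod_congr rfl fun i hi => ?_
      simp only [mem_erase, mem_univ, and_true] at hi
      rw [lehmer_mul_swap_of_ne w hr hi.2 hi.1]
    have hP' : rename (swap r r') (∏ i ∈ (univ.erase r).erase r',
        (X i : MvPolynomial (Fin n) ℂ) ^ lehmer w i) =
        ∏ i ∈ (univ.erase r).erase r', X i ^ lehmer w i := by
      rw [map_prod]
      refine prod_congr rfl fun i hi => ?_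
      simp only [mem_erase, mem_univ, and_true] at hi
      rw [map_pow, rename_X, swap_apply_of_ne_of_ne hi.2 hi.1]
    refine mul_left_cancel₀ (X_sub_X_ne_zero hne) ?_
    rw [hS.divDiff w r r' hr hlt, key, hsplit, hsplit, hP, hl, hl', heq]
    simp only [map_mul, map_pow, rename_X, swap_apply_left, swap_apply_right, hP']
    ring

lemma IsSchubertFamily.apply_one {S : Perm (Fin n) → MvPolynomial (Fin n) ℂ}
    (hS : IsSchubertFamily S) : S 1 = 1 := by
  have h : ∀ i : Fin n, lehmer 1 i = 0 := fun i => by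
    rw [lehmer, card_eq_zero, filter_eq_empty_iff]
    rintro j - ⟨h1, h2⟩
    exact h1.not_gt h2
  rw [hS.eq_prod_of_dominant 1 (fun q q' _ => by rw [h, h])]
  simp [h]

lemma invCount_one : invCount (1 : Perm (Fin n)) = 0 := by
  rw [invCount, card_eq_zero, filter_eq_empty_iff]
  rintro p - ⟨h1, h2⟩
  exact h1.not_gt h2

end Dominant

section PowerSums

variable {n : ℕ} {S : Perm (Fin n) → MvPolynomial (Fin n) ℂ}

local notation "mk" => Ideal.Quotient.mk (coinvIdeal n)

lemma IsSchubertFamily.mk_X_mul_mem_span (hS : IsSchubertFamily S) {T T' : Set (Perm (Fin n))}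
    (hT : ∀ w ∈ T, ∀ p ∈ covers w, w * swap p.1 p.2 ∈ T')
    {a : MvPolynomial (Fin n) ℂ ⧸ coinvIdeal n}
    (ha : a ∈ Submodule.span ℂ ((fun w => mk (S w)) '' T)) (m : Fin n) :
    mk (X m) * a ∈ Submodule.span ℂ ((fun w => mk (S w)) '' T') := by
  induction ha using Submodule.span_induction with
  | mem a ha =>
    obtain ⟨w, hw, rfl⟩ := ha
    dsimp only
    rw [← map_mul, hS.monk]
    exact sum_mem fun p hp => Submodule.smul_mem _ _
      (Submodule.subset_span ⟨_, hT w hw p hp, rfl⟩)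
  | zero => rw [mul_zero]; exact zero_mem _
  | add a b _ _ ha hb => rw [mul_add]; exact add_mem ha hb
  | smul c a _ ha => rw [mul_smul_comm]; exact Submodule.smul_mem _ _ ha

lemma IsSchubertFamily.mk_mem_span (hS : IsSchubertFamily S) (f : MvPolynomial (Fin n) ℂ) :
    mk f ∈ Submodule.span ℂ ((fun w => mk (S w)) '' Set.univ) := by
  induction f using MvPolynomial.induction_on with
  | C c =>
    have h : mk (C c) = c • mk (S 1) := by
      rw [hS.apply_one, ← mk_smul, smul_eq_C_mul, mul_one]
    rw [h]
    exact Submodule.smul_mem _ _ (Submodule.subset_span ⟨1, Set.mem_univ _, rfl⟩)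
  | add p q hp hq => rw [map_add]; exact add_mem hp hq
  | mul_X p k hp =>
    rw [mul_comm, map_mul]
    exact hS.mk_X_mul_mem_span (fun _ _ _ _ => Set.mem_univ _) hp k

lemma IsSchubertFamily.mk_X_mul_mem_span_invCount (hS : IsSchubertFamily S) {d : ℕ}
    {f : MvPolynomial (Fin n) ℂ}
    (hf : mk f ∈ Submodule.span ℂ ((fun w => mk (S w)) '' {w | invCount w = d})) (m : Fin n) :
    mk (X m * f) ∈ Submodule.span ℂ ((fun w => mk (S w)) '' {w | invCount w = d + 1}) := by
  rw [map_mul]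
  refine hS.mk_X_mul_mem_span (fun w hw p hp => ?_) hf m
  rw [Set.mem_ofPred_eq] at hw ⊢
  rw [(mem_covers.1 hp).2, hw]

lemma IsSchubertFamily.mk_X_pow_mul_mem_span_invCount (hS : IsSchubertFamily S) {d : ℕ}
    {f : MvPolynomial (Fin n) ℂ}
    (hf : mk f ∈ Submodule.span ℂ ((fun w => mk (S w)) '' {w | invCount w = d})) (m : Fin n)
    (k : ℕ) :
    mk (X m ^ k * f) ∈ Submodule.span ℂ ((fun w => mk (S w)) '' {w | invCount w = k + d}) := by
  induction k with
  | zero => simpa using hf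
  | succ k ih =>
    rw [pow_succ', mul_assoc, add_right_comm]
    exact hS.mk_X_mul_mem_span_invCount ih m

lemma IsSchubertFamily.mk_prod_mem_span_invCount (hS : IsSchubertFamily S) {ι : Type*}
    (s : Finset ι) (f : ι → Fin n) (k : ι → ℕ) :
    mk (∏ t ∈ s, X (f t) ^ k t) ∈
      Submodule.span ℂ ((fun w => mk (S w)) '' {w | invCount w = ∑ t ∈ s, k t}) := by
  induction s using Finset.induction_on with
  | empty =>
    rw [prod_empty, sum_empty, ← hS.apply_one]
    exact Submodule.subset_span ⟨1, invCount_one, rfl⟩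
  | insert t s ht ih =>
    rw [prod_insert ht, sum_insert ht]
    exact hS.mk_X_pow_mul_mem_span_invCount ih _ _

/-- The coinvariant algebra vanishes above degree `n.choose 2`. -/
lemma IsSchubertFamily.X_mul_prod_mem_coinvIdeal (hS : IsSchubertFamily S) {ι : Type*}
    [Fintype ι] (f : ι → Fin n) (k : ι → ℕ) (hk : n.choose 2 ≤ ∑ t, k t) (m : Fin n) :
    X m * ∏ t, X (f t) ^ k t ∈ coinvIdeal n := by
  have h := hS.mk_X_mul_mem_span_invCount (hS.mk_prod_mem_span_invCount univ f k) m
  have he : {w : Perm (Fin n) | invCount w = ∑ t, k t + 1} = ∅ := by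
    refine Set.eq_empty_of_forall_notMem fun w hw => ?_
    rw [Set.mem_ofPred_eq] at hw
    have := invCount_le w
    omega
  rw [he, Set.image_empty, Submodule.span_empty, Submodule.mem_bot] at h
  exact Ideal.Quotient.eq_zero_iff_mem.1 h

/-- The operator of the signed Chevalley-type sum is induced by `-∑ xᵢ² ∂/∂xᵢ`. -/
lemma IsSchubertFamily.eq_neg_mk_sqDeriv (hS : IsSchubertFamily S)
    {R : Module.End ℂ (MvPolynomial (Fin n) ℂ ⧸ coinvIdeal n)}
    (hR : ∀ w, R (mk (S w)) = ∑ p ∈ covers w,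
      ((bQ w p.1 p.2 : ℂ) - (dQ w p.1 p.2 : ℂ)) • mk (S (w * swap p.1 p.2)))
    (f : MvPolynomial (Fin n) ℂ) : R (mk f) = -mk (sqDeriv n f) := by
  have key : ∀ a ∈ Submodule.span ℂ ((fun w => mk (S w)) '' Set.univ),
      ∃ g, a = mk g ∧ R a = -mk (sqDeriv n g) := by
    intro a ha
    induction ha using Submodule.span_induction with
    | mem a ha =>
      obtain ⟨w, -, rfl⟩ := ha
      refine ⟨S w, rfl, ?_⟩
      dsimp only
      rw [hR, hS.mk_sqDeriv, ← sum_neg_distrib]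
      refine sum_congr rfl fun p _ => ?_
      rw [← neg_smul, neg_sub]
    | zero => exact ⟨0, by simp, by simp⟩
    | add a b _ _ ha hb =>
      obtain ⟨g, rfl, hg⟩ := ha
      obtain ⟨g', rfl, hg'⟩ := hb
      refine ⟨g + g', (map_add _ _ _).symm, ?_⟩
      rw [map_add R, hg, hg', map_add, map_add, neg_add]
    | smul c a _ ha =>
      obtain ⟨g, rfl, hg⟩ := ha
      refine ⟨c • g, (mk_smul c g).symm, ?_⟩
      rw [map_smul R, hg, Derivation.map_smul, mk_smul, smul_neg]
  obtain ⟨g, hg, h⟩ := key _ (hS.mk_mem_span f)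
  rw [h, neg_inj, ← sub_eq_zero, ← map_sub, ← map_sub, Ideal.Quotient.eq_zero_iff_mem]
  refine sqDeriv_mem_coinvIdeal ?_
  rw [← Ideal.Quotient.eq, hg]

/-- The weighted power sum `∑ βᵢ xᵢᵏ`. -/
noncomputable def weightedPsum (β : Fin n → ℂ) (k : ℕ) : MvPolynomial (Fin n) ℂ :=
  ∑ i, C (β i) * X i ^ k

lemma sqDeriv_weightedPsum (β : Fin n → ℂ) (k : ℕ) :
    sqDeriv n (weightedPsum β k) = k • weightedPsum β (k + 1) := by
  rw [weightedPsum, weightedPsum, map_sum, smul_sum]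
  refine sum_congr rfl fun i _ => ?_
  rw [← smul_eq_C_mul, ← smul_eq_C_mul, Derivation.map_smul, Derivation.leibniz_pow, sqDeriv_X,
    smul_comm k (β i)]
  congr 1
  rcases k with _ | k
  · simp
  · rw [Nat.add_sub_cancel, smul_eq_mul, ← pow_add]

/-- The span of the products of `c` weighted power sums of total degree `d`. -/
noncomputable def psumSpan (β : Fin n → ℂ) (c d : ℕ) : Submodule ℂ (MvPolynomial (Fin n) ℂ) :=
  Submodule.span ℂ {f | ∃ s : Multiset ℕ, s.card = c ∧ s.sum = d ∧
    f = (s.map (weightedPsum β)).prod}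

lemma weightedPsum_mul_mem_psumSpan {β : Fin n → ℂ} {c d k : ℕ} {f : MvPolynomial (Fin n) ℂ}
    (hf : f ∈ psumSpan β c d) : weightedPsum β k * f ∈ psumSpan β (c + 1) (k + d) := by
  induction hf using Submodule.span_induction with
  | mem f hf =>
    obtain ⟨s, hc, hd, rfl⟩ := hf
    exact Submodule.subset_span ⟨k ::ₘ s, by simp [hc], by simp [hd], by simp⟩
  | zero => rw [mul_zero]; exact zero_mem _
  | add a b _ _ ha hb => rw [mul_add]; exact add_mem ha hb
  | smul c a _ ha => rw [mul_smul_comm]; exact Submodule.smul_mem _ _ ha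

lemma sqDeriv_prod_mem_psumSpan (β : Fin n → ℂ) (s : Multiset ℕ) :
    sqDeriv n (s.map (weightedPsum β)).prod ∈ psumSpan β s.card (s.sum + 1) := by
  induction s using Multiset.induction_on with
  | empty => simp
  | cons k s ih =>
    rw [Multiset.map_cons, Multiset.prod_cons, Derivation.leibniz, smul_eq_mul, smul_eq_mul,
      Multiset.card_cons, Multiset.sum_cons, sqDeriv_weightedPsum, mul_smul_comm, mul_comm _
      (weightedPsum β (k + 1)), add_assoc]
    refine add_mem (weightedPsum_mul_mem_psumSpan ih) (nsmul_mem ?_ k)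
    rw [add_comm s.sum 1, ← add_assoc]
    exact weightedPsum_mul_mem_psumSpan (Submodule.subset_span ⟨s, rfl, rfl, rfl⟩)

lemma sqDeriv_mem_psumSpan {β : Fin n → ℂ} {c d : ℕ} {f : MvPolynomial (Fin n) ℂ}
    (hf : f ∈ psumSpan β c d) : sqDeriv n f ∈ psumSpan β c (d + 1) := by
  induction hf using Submodule.span_induction with
  | mem f hf =>
    obtain ⟨s, rfl, rfl, rfl⟩ := hf
    exact sqDeriv_prod_mem_psumSpan β s
  | zero => rw [map_zero]; exact zero_mem _
  | add a b _ _ ha hb => rw [map_add]; exact add_mem ha hb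
  | smul c a _ ha => rw [Derivation.map_smul]; exact Submodule.smul_mem _ _ ha

lemma pow_weightedPsum_mem_psumSpan (β : Fin n → ℂ) (d : ℕ) :
    weightedPsum β 1 ^ d ∈ psumSpan β d d :=
  Submodule.subset_span ⟨Multiset.replicate d 1, by simp, by simp, by simp⟩

/-- The span of the products of fewer than `d` weighted power sums of total degree `d`. -/
noncomputable def shortPsumSpan (β : Fin n → ℂ) (d : ℕ) : Submodule ℂ (MvPolynomial (Fin n) ℂ) :=
  ⨆ c : Fin d, psumSpan β c d

lemma psumSpan_le_shortPsumSpan {β : Fin n → ℂ} {c d : ℕ} (h : c < d) :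
    psumSpan β c d ≤ shortPsumSpan β d :=
  le_iSup (fun c : Fin d => psumSpan β c d) ⟨c, h⟩

lemma weightedPsum_one_mul_mem_shortPsumSpan {β : Fin n → ℂ} {d : ℕ}
    {f : MvPolynomial (Fin n) ℂ} (hf : f ∈ shortPsumSpan β d) :
    weightedPsum β 1 * f ∈ shortPsumSpan β (d + 1) := by
  induction hf using Submodule.iSup_induction' with
  | mem c f hf =>
    refine psumSpan_le_shortPsumSpan (Nat.succ_lt_succ c.2) ?_
    rw [Nat.succ_eq_one_add d]
    exact weightedPsum_mul_mem_psumSpan hf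
  | zero => rw [mul_zero]; exact zero_mem _
  | add a b _ _ ha hb => rw [mul_add]; exact add_mem ha hb

lemma sqDeriv_mem_shortPsumSpan {β : Fin n → ℂ} {d : ℕ}
    {f : MvPolynomial (Fin n) ℂ} (hf : f ∈ shortPsumSpan β d) :
    sqDeriv n f ∈ shortPsumSpan β (d + 1) := by
  induction hf using Submodule.iSup_induction' with
  | mem c f hf =>
    exact psumSpan_le_shortPsumSpan (Nat.lt_succ_of_lt c.2) (sqDeriv_mem_psumSpan hf)
  | zero => rw [map_zero]; exact zero_mem _
  | add a b _ _ ha hb => rw [map_add]; exact add_mem ha hb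

lemma exists_pow_apply_one_eq (β : Fin n → ℂ) (z : ℂ)
    {M R : Module.End ℂ (MvPolynomial (Fin n) ℂ ⧸ coinvIdeal n)}
    (hM : ∀ f, M (mk f) = mk (weightedPsum β 1 * f))
    (hR : ∀ f, R (mk f) = -mk (sqDeriv n f)) (d : ℕ) :
    ∃ j ∈ shortPsumSpan β d, ((M + z • R) ^ d) 1 = mk (weightedPsum β 1 ^ d + j) := by
  induction d with
  | zero => exact ⟨0, zero_mem _, by simp⟩
  | succ d ih =>
    obtain ⟨j, hj, h⟩ := ih
    refine ⟨weightedPsum β 1 * j + (-z) • sqDeriv n (weightedPsum β 1 ^ d + j), ?_, ?_⟩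
    · refine add_mem (weightedPsum_one_mul_mem_shortPsumSpan hj) (Submodule.smul_mem _ _ ?_)
      rw [map_add]
      exact add_mem (psumSpan_le_shortPsumSpan (Nat.lt_succ_self d)
        (sqDeriv_mem_psumSpan (pow_weightedPsum_mem_psumSpan β d))) (sqDeriv_mem_shortPsumSpan hj)
    · rw [pow_succ', Module.End.mul_apply, h, LinearMap.add_apply, LinearMap.smul_apply, hM, hR,
        pow_succ', ← add_assoc, ← mul_add, map_add mk (weightedPsum β 1 * _), mk_smul, neg_smul,
        smul_neg]

/-- The sum of the monomials `∏ t, X (f t) ^ k t` over the maps `f` with prescribed fiber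
cardinalities. -/
noncomputable def fiberSum {r : ℕ} (k : Fin r → ℕ) (q : Fin n → ℕ) : MvPolynomial (Fin n) ℂ :=
  ∑ f : Fin r → Fin n, if (∀ i, #{t | f t = i} = q i) then ∏ t, X (f t) ^ k t else 0

lemma rename_swap_fiberSum {r : ℕ} (k : Fin r → ℕ) {q : Fin n → ℕ} {i j : Fin n}
    (hij : q i = q j) : rename (swap i j) (fiberSum k q) = fiberSum k q := by
  have hq : ∀ l, q (swap i j l) = q l := by
    intro l
    rcases swap_apply_eq_iff.1 (rfl : swap i j l = _) with h
    by_cases h1 : l = i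
    · rw [h1, swap_apply_left, hij]
    by_cases h2 : l = j
    · rw [h2, swap_apply_right, hij]
    rw [swap_apply_of_ne_of_ne h1 h2]
  rw [fiberSum, map_sum, ← Equiv.sum_comp (Equiv.arrowCongr (Equiv.refl (Fin r)) (swap i j))]
  refine sum_congr rfl fun f _ => ?_
  have h1 : (∀ l, #{t | (Equiv.arrowCongr (Equiv.refl (Fin r)) (swap i j)) f t = l} = q l) ↔
      ∀ l, #{t | f t = l} = q l := by
    rw [← (swap i j).forall_congr_right]
    simp [hq]
  simp only [h1]
  rw [apply_ite (rename (swap i j)), map_prod, map_zero]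
  simp

lemma not_injective_of_sum_lt {q : Fin n → ℕ} (h : ∑ i, q i < n.choose 2) :
    ∃ i j, i ≠ j ∧ q i = q j := by
  by_contra! hq
  have hinj : Function.Injective q := fun i j h => by
    by_contra hne
    exact hq i j hne h
  have h1 := Finset.sum_range_le_sum (s := univ.image (fun i => (q i : ℤ))) (c := 0) (by simp)
  rw [sum_image (fun i _ j _ h => hinj (by exact_mod_cast h)),
    card_image_of_injective _ (fun i j h => hinj (by exact_mod_cast h)), card_univ,
    Fintype.card_fin] at h1
  simp only [zero_add] at h1
  have h2 : ∑ i ∈ range n, i ≤ ∑ i, q i := by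
    rw [← Nat.cast_le (α := ℤ)]
    push_cast
    exact h1
  rw [sum_range_id, ← Nat.choose_two_right] at h2
  omega

lemma IsSchubertFamily.fiberSum_mem (hS : IsSchubertFamily S) {r : ℕ} (hr : r < n.choose 2)
    (k : Fin r → ℕ) (hk : ∑ t, k t = n.choose 2) (q : Fin n → ℕ) :
    fiberSum k q ∈ coinvIdeal n := by
  by_cases h : ∑ i, q i = r
  · obtain ⟨i, j, hij, hq⟩ := not_injective_of_sum_lt (h.trans_lt hr)
    refine mem_coinvIdeal_of_swap_invariant hij (rename_swap_fiberSum k hq) ?_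
    rw [fiberSum, mul_sum]
    refine sum_mem fun f _ => ?_
    split_ifs
    · exact hS.X_mul_prod_mem_coinvIdeal f k hk.ge i
    · rw [mul_zero]; exact zero_mem _
  · refine sum_mem fun f _ => ?_
    rw [if_neg]
    · exact zero_mem _
    · refine fun hf => h ?_
      rw [← sum_congr rfl fun i _ => hf i, ← card_eq_sum_card_fiberwise (t := univ) (by simp)]
      simp

lemma IsSchubertFamily.prod_weightedPsum_mem (hS : IsSchubertFamily S) (β : Fin n → ℂ) {r : ℕ}
    (hr : r < n.choose 2) (k : Fin r → ℕ) (hk : ∑ t, k t = n.choose 2) :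
    ∏ t, weightedPsum β (k t) ∈ coinvIdeal n := by
  have h : ∏ t, weightedPsum β (k t) =
      ∑ q ∈ univ.image (fun (f : Fin r → Fin n) i => #{t | f t = i}),
        (∏ i, C (β i) ^ q i) * fiberSum k q := by
    simp only [weightedPsum]
    rw [prod_univ_sum, Fintype.piFinset_univ,
      ← sum_fiberwise_of_maps_to (t := univ.image (fun (f : Fin r → Fin n) i => #{t | f t = i}))
        (g := fun (f : Fin r → Fin n) i => #{t | f t = i})
        fun f hf => mem_image_of_mem _ hf]
    refine sum_congr rfl fun q _ => ?_
    rw [fiberSum, ← sum_filter, mul_sum]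
    have : (univ.filter fun f : Fin r → Fin n => (fun i => #{t | f t = i}) = q) =
        univ.filter fun f : Fin r → Fin n => ∀ i, #{t | f t = i} = q i := by
      ext f
      rw [mem_filter, mem_filter, funext_iff]
    rw [this]
    refine sum_congr rfl fun f hf => ?_
    rw [prod_mul_distrib]
    congr 1
    rw [← prod_fiberwise_of_maps_to (t := univ) (g := f) (by simp)]
    refine prod_congr rfl fun i _ => ?_
    rw [← (mem_filter.1 hf).2 i]
    exact prod_eq_pow_card fun t ht => by rw [(mem_filter.1 ht).2]
  rw [h]
  exact sum_mem fun q _ => Ideal.mul_mem_left _ _ (hS.fiberSum_mem hr k hk q)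

lemma IsSchubertFamily.mem_coinvIdeal_of_mem_shortPsumSpan (hS : IsSchubertFamily S)
    {β : Fin n → ℂ} {f : MvPolynomial (Fin n) ℂ} (hf : f ∈ shortPsumSpan β (n.choose 2)) :
    f ∈ coinvIdeal n := by
  suffices H : shortPsumSpan β (n.choose 2) ≤ (coinvIdeal n).restrictScalars ℂ from H hf
  refine iSup_le fun c => Submodule.span_le.2 ?_
  rintro _ ⟨s, hc, hd, rfl⟩
  induction s using Quotient.inductionOn with
  | h l =>
    have hl : l.length < n.choose 2 := by
      have := c.2
      rw [← hc] at this
      simpa using this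
    have := hS.prod_weightedPsum_mem β hl l.get (by
      have h := hd
      simp only [Multiset.quot_mk_to_coe, Multiset.sum_coe] at h
      rw [← h, Fin.sum_univ_def]
      simp)
    have he : ((Multiset.map (weightedPsum β) ↑l).prod) = ∏ t, weightedPsum β (l.get t) := by
      rw [Multiset.map_coe, Multiset.prod_coe]
      simp
    simp only [Multiset.quot_mk_to_coe, SetLike.mem_coe, Submodule.restrictScalars_mem]
    rwa [he]

end PowerSums
/-- In the coinvariant algebra `ℂ[x]/I`, let `M` be multiplication by
`β₁x₁ + ⋯ + β_{n-1}x_{n-1}` and let `R` be the operator acting on the Schubert basis by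
`R 𝔖_w = Σ_{w ⋖ u} (b_{w⋖u} - d_{w⋖u}) 𝔖_u`.  Then `R·1 = 0` and
`(M + zR)^{C(n,2)}·1 = M^{C(n,2)}·1` for any scalar `z`.  The Schubert polynomials `S w`
are characterized by `S w₀ = x^ρ` and the divided-difference recursion. -/
theorem MplusZR_pow_one {n : ℕ} (S : Equiv.Perm (Fin n) → MvPolynomial (Fin n) ℂ)
    (hS0 : S Fin.revPerm = ∏ i : Fin n, X i ^ (n - 1 - (i : ℕ)))
    (hSrec : ∀ (w : Equiv.Perm (Fin n)) (i : Fin n) (h : (i : ℕ) + 1 < n),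
      invCount (w * Equiv.swap i ⟨(i : ℕ) + 1, h⟩) < invCount w →
      (X i - X ⟨(i : ℕ) + 1, h⟩) * S (w * Equiv.swap i ⟨(i : ℕ) + 1, h⟩) =
        S w - rename (Equiv.swap i ⟨(i : ℕ) + 1, h⟩) (S w))
    (β : Fin n → ℂ) (z : ℂ)
    (M : Module.End ℂ (MvPolynomial (Fin n) ℂ ⧸ coinvIdeal n))
    (hM : M = LinearMap.mulLeft ℂ (Ideal.Quotient.mk (coinvIdeal n)
      (∑ i ∈ Finset.univ.filter (fun i : Fin n => (i : ℕ) + 1 < n), C (β i) * X i)))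
    (R : Module.End ℂ (MvPolynomial (Fin n) ℂ ⧸ coinvIdeal n))
    (hR : ∀ w : Equiv.Perm (Fin n),
      R (Ideal.Quotient.mk (coinvIdeal n) (S w)) =
        ∑ p ∈ Finset.univ.filter (fun p : Fin n × Fin n =>
            p.1 < p.2 ∧ invCount (w * Equiv.swap p.1 p.2) = invCount w + 1),
          ((bQ w p.1 p.2 : ℂ) - (dQ w p.1 p.2 : ℂ)) •
            Ideal.Quotient.mk (coinvIdeal n) (S (w * Equiv.swap p.1 p.2))) :
    R 1 = 0 ∧ ((M + z • R) ^ n.choose 2) 1 = (M ^ n.choose 2) 1 := by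
  have hS : IsSchubertFamily S := by
    refine ⟨hS0, fun v r r' hr hv => ?_⟩
    have hlt : (r : ℕ) + 1 < n := hr ▸ r'.2
    obtain rfl : r' = ⟨(r : ℕ) + 1, hlt⟩ := Fin.ext hr
    have h := hSrec (v * swap r ⟨(r : ℕ) + 1, hlt⟩) r hlt
    rw [mul_assoc, swap_mul_self, mul_one] at h
    exact h (by rw [invCount_mul_swap_of_lt rfl hv]; exact Nat.lt_succ_self _)
  have hR' := hS.eq_neg_mk_sqDeriv hR
  set β' : Fin n → ℂ := fun i => if (i : ℕ) + 1 < n then β i else 0 with hβ'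
  have hM' : ∀ f, M (Ideal.Quotient.mk (coinvIdeal n) f) =
      Ideal.Quotient.mk (coinvIdeal n) (weightedPsum β' 1 * f) := by
    intro f
    rw [hM, LinearMap.mulLeft_apply, ← map_mul, weightedPsum, sum_filter]
    congr 2
    refine sum_congr rfl fun i _ => ?_
    rw [hβ', pow_one]
    dsimp only
    split_ifs <;> simp
  refine ⟨?_, ?_⟩
  · rw [← map_one (Ideal.Quotient.mk (coinvIdeal n)), hR']
    simp
  · obtain ⟨j, hj, h⟩ := exists_pow_apply_one_eq β' z hM' hR' (n.choose 2)
    obtain ⟨j', hj', h'⟩ := exists_pow_apply_one_eq β' 0 hM' hR' (n.choose 2)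
    rw [zero_smul, add_zero] at h'
    rw [h, h', Ideal.Quotient.eq, add_sub_add_left_eq_sub]
    exact sub_mem (hS.mem_coinvIdeal_of_mem_shortPsumSpan hj)
      (hS.mem_coinvIdeal_of_mem_shortPsumSpan hj')
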